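/- Fix n ≥ 3 and 0 < p < 1. The probability that a random graph Γ ∈ G(n, p) fails to be star 2-connected is at most 2n²·(1−p)^{−1}·(p + (1−p)²)^{n−1} + n·(1−p)^{−4}·(p + 2(1−p)³)^{n−1}. -/

import Mathlib

open Finset Filter Topology

attribute [local instance] Classical.propDecidable

/-- The Erdős–Rényi weight of a graph `Γ` on `n` vertices with edge probability `p`:
`p^{E_Γ} (1-p)^{C(n,2) - E_Γ}`. -/
noncomputable def gnpWeight (n : ℕ) (p : ℝ) (Γ : SimpleGraph (Fin n)) : ℝ :=
  p ^ Γ.edgeSet.ncard * (1 - p) ^ (n.choose 2 - Γ.edgeSet.ncard)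

/-- The probability of the event `A` under the Erdős–Rényi model `G(n,p)`. -/
noncomputable def gnpProb (n : ℕ) (p : ℝ) (A : SimpleGraph (Fin n) → Prop) : ℝ :=
  ∑ Γ : SimpleGraph (Fin n), if A Γ then gnpWeight n p Γ else 0

/-- The expectation of a random variable `X` under the Erdős–Rényi model `G(n,p)`. -/
noncomputable def gnpExp (n : ℕ) (p : ℝ) (X : SimpleGraph (Fin n) → ℝ) : ℝ :=
  ∑ Γ : SimpleGraph (Fin n), gnpWeight n p Γ * X Γ

/-- A graph is star 2-connected if there is no vertex `v` and no partition of the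
vertices outside `st(v)` into two nonempty sets `S`, `T` with no edge joining `S` to `T`. -/
def StarTwoConnected {n : ℕ} (Γ : SimpleGraph (Fin n)) : Prop :=
  ¬ ∃ (v : Fin n) (S T : Finset (Fin n)),
      S.Nonempty ∧ T.Nonempty ∧ Disjoint S T ∧
      (∀ u : Fin n, u ∈ S ∪ T ↔ (u ≠ v ∧ ¬ Γ.Adj v u)) ∧
      (∀ s ∈ S, ∀ t ∈ T, ¬ Γ.Adj s t)

/-- Summing a function of the edge set over all graphs is summing it over all sets of
non-diagonal unordered pairs. -/
theorem sum_simpleGraph_edgeFinset {V M : Type*} [Fintype V] [Fintype (SimpleGraph V)]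
    [AddCommMonoid M]
    {D : Finset (Sym2 V)} (hD : ∀ e, e ∈ D ↔ ¬ e.IsDiag) (f : Finset (Sym2 V) → M) :
    ∑ Γ : SimpleGraph V, f Γ.edgeFinset = ∑ F ∈ D.powerset, f F := by
  refine Finset.sum_bij' (fun Γ _ => Γ.edgeFinset)
    (fun F _ => SimpleGraph.fromEdgeSet (F : Set (Sym2 V))) ?_ ?_ ?_ ?_ ?_
  · intro Γ _
    rw [mem_powerset]
    intro e he
    rw [SimpleGraph.mem_edgeFinset] at he
    exact (hD e).2 (Γ.not_isDiag_of_mem_edgeSet he)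
  · simp
  · intro Γ _
    simp
  · intro F hF
    rw [mem_powerset] at hF
    ext e
    rw [@SimpleGraph.mem_edgeFinset _ _ _ (_), SimpleGraph.edgeSet_fromEdgeSet]
    simp only [Set.mem_sdiff, mem_coe]
    refine ⟨fun h => h.1, fun h => ⟨h, ?_⟩⟩
    exact (hD e).1 (hF h)
  · simp

theorem gnpWeight_nonneg {n : ℕ} {p : ℝ} (hp0 : 0 ≤ p) (hp1 : p ≤ 1)
    (Γ : SimpleGraph (Fin n)) : 0 ≤ gnpWeight n p Γ :=
  mul_nonneg (pow_nonneg hp0 _) (pow_nonneg (sub_nonneg.2 hp1) _)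

/-- The union bound in `G(n,p)`. -/
theorem gnpProb_le_sum {n : ℕ} {p : ℝ} (hp0 : 0 ≤ p) (hp1 : p ≤ 1) {ι : Type*}
    (I : Finset ι) (A : SimpleGraph (Fin n) → Prop) (B : ι → SimpleGraph (Fin n) → Prop)
    (h : ∀ Γ, A Γ → ∃ i ∈ I, B i Γ) :
    gnpProb n p A ≤ ∑ i ∈ I, gnpProb n p (B i) := by
  unfold gnpProb
  rw [Finset.sum_comm]
  refine Finset.sum_le_sum fun Γ _ => ?_
  have hnn : ∀ i ∈ I, 0 ≤ if B i Γ then gnpWeight n p Γ else 0 := fun i _ => by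
    split_ifs
    exacts [gnpWeight_nonneg hp0 hp1 Γ, le_rfl]
  split_ifs with hA
  · obtain ⟨i, hi, hB⟩ := h Γ hA
    calc gnpWeight n p Γ = if B i Γ then gnpWeight n p Γ else 0 := by rw [if_pos hB]
      _ ≤ _ := Finset.single_le_sum hnn hi
  · exact Finset.sum_nonneg hnn

/-- The sum of the Bernoulli weights of the sets that contain `E₁` and avoid `E₀`. -/
theorem sum_powerset_weight_contains_avoids {α : Type*} {p : ℝ} {D E₀ E₁ : Finset α}
    (h₀ : E₀ ⊆ D) (h₁ : E₁ ⊆ D) (hd : Disjoint E₀ E₁) :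
    (∑ F ∈ D.powerset, if E₁ ⊆ F ∧ Disjoint E₀ F then p ^ #F * (1 - p) ^ (#D - #F) else 0) =
      p ^ #E₁ * (1 - p) ^ #E₀ := by
  have hterm : ∀ F ∈ D.powerset,
      (if E₁ ⊆ F ∧ Disjoint E₀ F then p ^ #F * (1 - p) ^ (#D - #F) else 0) =
      (∏ e ∈ F, if e ∈ E₀ then 0 else p) * ∏ e ∈ D \ F, if e ∈ E₁ then 0 else 1 - p := by
    intro F hF
    rw [mem_powerset] at hF
    split_ifs with h
    · have hp : (∏ e ∈ F, if e ∈ E₀ then 0 else p) = p ^ #F :=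
        Finset.prod_eq_pow_card fun e he => if_neg (Finset.disjoint_right.1 h.2 he)
      have hq : (∏ e ∈ D \ F, if e ∈ E₁ then 0 else 1 - p) = (1 - p) ^ #(D \ F) :=
        Finset.prod_eq_pow_card fun e he => if_neg fun h' => (Finset.mem_sdiff.1 he).2 (h.1 h')
      rw [hp, hq, Finset.card_sdiff_of_subset hF]
    · symm
      rw [not_and_or, Finset.not_subset, Finset.not_disjoint_iff] at h
      rcases h with ⟨e, he, heF⟩ | ⟨e, he, heF⟩
      · exact mul_eq_zero_of_right _
          (Finset.prod_eq_zero (Finset.mem_sdiff.2 ⟨h₁ he, heF⟩) (by rw [if_pos he]))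
      · exact mul_eq_zero_of_left (Finset.prod_eq_zero heF (by rw [if_pos he])) _
  have hfactor : ∀ e ∈ D, ((if e ∈ E₀ then 0 else p) + if e ∈ E₁ then 0 else 1 - p) =
      (if e ∈ E₁ then p else 1) * if e ∈ E₀ then 1 - p else 1 := by
    intro e _
    by_cases h0 : e ∈ E₀
    · simp [h0, Finset.disjoint_left.1 hd h0]
    · by_cases h1 : e ∈ E₁ <;> simp [h0, h1]
  rw [Finset.sum_congr rfl hterm, ← Finset.prod_add, Finset.prod_congr rfl hfactor,
    Finset.prod_mul_distrib, ← Finset.prod_filter, ← Finset.prod_filter,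
    Finset.filter_mem_eq_inter, Finset.filter_mem_eq_inter, Finset.inter_eq_right.2 h₀,
    Finset.inter_eq_right.2 h₁, Finset.prod_const, Finset.prod_const]

/-- In `G(n,p)`, the probability that all pairs in `E₁` are edges and no pair in `E₀` is an
edge. -/
theorem gnpProb_edges_present_absent {n : ℕ} {p : ℝ} {E₀ E₁ : Finset (Sym2 (Fin n))}
    (h₀ : ∀ e ∈ E₀, ¬ e.IsDiag) (h₁ : ∀ e ∈ E₁, ¬ e.IsDiag) (hd : Disjoint E₀ E₁) :
    gnpProb n p (fun Γ => (∀ e ∈ E₁, e ∈ Γ.edgeSet) ∧ ∀ e ∈ E₀, e ∉ Γ.edgeSet) =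
      p ^ #E₁ * (1 - p) ^ #E₀ := by
  obtain ⟨D, hD, hDcard⟩ : ∃ D : Finset (Sym2 (Fin n)),
      (∀ e, e ∈ D ↔ ¬ e.IsDiag) ∧ #D = n.choose 2 := by
    refine ⟨univ.filter fun e => ¬ e.IsDiag, fun e => by simp, ?_⟩
    rw [← Fintype.card_subtype, Sym2.card_subtype_not_diag, Fintype.card_fin]
  have hD₀ : E₀ ⊆ D := fun e he => (hD e).2 (h₀ e he)
  have hD₁ : E₁ ⊆ D := fun e he => (hD e).2 (h₁ e he)
  rw [← sum_powerset_weight_contains_avoids hD₀ hD₁ hd]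
  refine Eq.trans ?_ (sum_simpleGraph_edgeFinset hD _)
  rw [gnpProb]
  refine Finset.sum_congr rfl fun Γ _ => ?_
  have hcard : Γ.edgeSet.ncard = #Γ.edgeFinset := Set.ncard_eq_toFinset_card' _
  simp only [gnpWeight, hcard, hDcard, Finset.subset_iff, Finset.disjoint_left,
    SimpleGraph.mem_edgeFinset]
  congr

/-- The probability that `K` is the complement of the star of `v` and that no edge joins `S`
to `K \ S`. -/
theorem gnpProb_star_compl_eq_and_separated {n : ℕ} {p : ℝ} {v : Fin n} {K S : Finset (Fin n)}
    (hK : v ∉ K) (hS : S ⊆ K) :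
    gnpProb n p (fun Γ => (∀ u, u ∈ K ↔ u ≠ v ∧ ¬ Γ.Adj v u) ∧
        ∀ s ∈ S, ∀ t ∈ K \ S, ¬ Γ.Adj s t) =
      p ^ (n - 1 - #K) * (1 - p) ^ #K * (1 - p) ^ (#S * (#K - #S)) := by
  set E₁ : Finset (Sym2 (Fin n)) := (univ.erase v \ K).image fun u => s(v, u) with hE₁
  set E₂ : Finset (Sym2 (Fin n)) := K.image fun u => s(v, u) with hE₂
  set E₃ : Finset (Sym2 (Fin n)) := (S ×ˢ (K \ S)).image fun x => s(x.1, x.2) with hE₃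
  have hinj : Function.Injective fun u : Fin n => s(v, u) := fun a b h => Sym2.congr_right.1 h
  have c₁ : #E₁ = n - 1 - #K := by
    rw [hE₁, Finset.card_image_of_injective _ hinj, Finset.card_sdiff_of_subset,
      Finset.card_erase_of_mem (mem_univ v), Finset.card_univ, Fintype.card_fin]
    exact fun u hu => mem_erase.2 ⟨fun h => hK (h ▸ hu), mem_univ u⟩
  have c₂ : #E₂ = #K := Finset.card_image_of_injective _ hinj
  have c₃ : #E₃ = #S * (#K - #S) := by
    rw [hE₃, Finset.card_image_of_injOn, Finset.card_product, Finset.card_sdiff_of_subset hS]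
    rintro ⟨a, b⟩ hab ⟨c, d⟩ hcd h
    simp only [coe_product, Set.mem_prod, mem_coe, Finset.mem_sdiff] at hab hcd
    rcases Sym2.eq_iff.1 h with ⟨h1, h2⟩ | ⟨h1, h2⟩
    · exact Prod.ext h1 h2
    · exact absurd (show d ∈ S from (show a = d from h1) ▸ (show a ∈ S from hab.1)) hcd.2.2
  have d₂₃ : Disjoint E₂ E₃ := by
    rw [Finset.disjoint_left]
    rintro e h2 h3
    obtain ⟨u, -, rfl⟩ := mem_image.1 h2
    obtain ⟨⟨a, b⟩, hab, h⟩ := mem_image.1 h3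
    simp only [mem_product, Finset.mem_sdiff] at hab
    rcases Sym2.eq_iff.1 h with ⟨h1, -⟩ | ⟨-, h1⟩
    · exact hK (hS (h1 ▸ hab.1))
    · exact hK (h1 ▸ hab.2.1)
  have d : Disjoint (E₂ ∪ E₃) E₁ := by
    rw [Finset.disjoint_left]
    rintro e h23 h1
    obtain ⟨u, hu, rfl⟩ := mem_image.1 h1
    rcases mem_union.1 h23 with h2 | h3
    · obtain ⟨w, hw, h⟩ := mem_image.1 h2
      exact (Finset.mem_sdiff.1 hu).2 (hinj h ▸ hw)
    · obtain ⟨⟨a, b⟩, hab, h⟩ := mem_image.1 h3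
      simp only [mem_product, Finset.mem_sdiff] at hab
      rcases Sym2.eq_iff.1 h with ⟨h1, -⟩ | ⟨-, h1⟩
      · exact hK (hS (h1 ▸ hab.1))
      · exact hK (h1 ▸ hab.2.1)
  have key := gnpProb_edges_present_absent (p := p) (E₀ := E₂ ∪ E₃) (E₁ := E₁) ?_ ?_ d
  · rw [Finset.card_union_of_disjoint d₂₃, c₁, c₂, c₃, pow_add, ← mul_assoc] at key
    rw [← key]
    congr 1
    funext Γ
    apply propext
    simp only [hE₁, hE₂, hE₃, mem_union, forall_mem_image, or_imp, forall_and, mem_product,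
      SimpleGraph.mem_edgeSet, Finset.mem_sdiff, mem_erase, mem_univ, Prod.forall]
    constructor
    · rintro ⟨h1, h2⟩
      refine ⟨fun u hu => ?_, fun u hu => ((h1 u).1 hu).2, fun a b hab => h2 a hab.1 b hab.2⟩
      by_contra h
      exact hu.2 ((h1 u).2 ⟨hu.1.1, h⟩)
    · rintro ⟨h1, h2, h3⟩
      refine ⟨fun u => ⟨fun hu => ⟨fun h => hK (h ▸ hu), h2 hu⟩, fun hu => ?_⟩,
        fun a ha b hb => h3 a b ⟨ha, hb⟩⟩
      by_contra h
      exact hu.2 (h1 ⟨⟨hu.1, trivial⟩, h⟩)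
  · intro e he
    rcases mem_union.1 he with h2 | h3
    · obtain ⟨u, hu, rfl⟩ := mem_image.1 h2
      rw [Sym2.mk_isDiag_iff]
      exact fun h => hK (h ▸ hu)
    · obtain ⟨⟨a, b⟩, hab, rfl⟩ := mem_image.1 h3
      simp only [mem_product, Finset.mem_sdiff] at hab
      rw [Sym2.mk_isDiag_iff]
      exact fun h => hab.2.2 ((show a = b from h) ▸ hab.1)
  · intro e he
    obtain ⟨u, hu, rfl⟩ := mem_image.1 he
    rw [Sym2.mk_isDiag_iff]
    exact fun h => (mem_erase.1 (Finset.mem_sdiff.1 hu).1).1 h.symm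

theorem pow_mul_sub_le {q : ℝ} (hq0 : 0 < q) (hq1 : q ≤ 1) {j k : ℕ} (hj : 0 < j) (hjk : j < k) :
    q ^ (j * (k - j)) ≤ (if j = 1 then q⁻¹ * q ^ k else 0) +
      (if j = k - 1 then q⁻¹ * q ^ k else 0) + (q ^ 4)⁻¹ * (q ^ 2) ^ k := by
  obtain ⟨l, rfl⟩ := Nat.exists_eq_add_of_lt hjk
  have hk : j + l + 1 - j = l + 1 := by omega
  have e1 : q⁻¹ * q ^ (j + l + 1) = q ^ (j + l) := by
    rw [pow_succ]
    field_simp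
  rw [hk, e1]
  have hpos : 0 ≤ (q ^ 4)⁻¹ * (q ^ 2) ^ (j + l + 1) := by positivity
  have hpos' : 0 ≤ q ^ (j + l) := by positivity
  by_cases h1 : j = 1
  · rw [if_pos h1]
    have : q ^ (j * (l + 1)) = q ^ (j + l) := by
      rw [h1]
      congr 1
      ring
    rw [this]
    split_ifs <;> linarith
  by_cases h2 : l = 0
  · have : q ^ (j * (l + 1)) = q ^ (j + l) := by simp [h2]
    rw [this, if_neg h1, if_pos (show j = j + l + 1 - 1 by omega)]
    linarith
  obtain ⟨a, rfl⟩ := Nat.exists_eq_add_of_le (show 2 ≤ j by omega)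
  obtain ⟨b, rfl⟩ := Nat.exists_eq_add_of_le (show 1 ≤ l by omega)
  have e2 : (q ^ 4)⁻¹ * (q ^ 2) ^ (2 + a + (1 + b) + 1) = q ^ (2 * a + 2 * b + 4) := by
    rw [← pow_mul, inv_mul_eq_iff_eq_mul₀ (by positivity), ← pow_add]
    congr 1
    ring
  rw [if_neg h1, if_neg (by omega), zero_add, zero_add, e2]
  refine pow_le_pow_of_le_one hq0.le hq1 ?_
  nlinarith [Nat.zero_le (a * b)]

/-- The expected number of ordered separations of a random graph on the vertex set `K`, bounded
by separating off the separations with a part of size one. -/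
theorem sum_separations_le {α : Type*} {q : ℝ} (hq0 : 0 < q) (hq1 : q ≤ 1) (K : Finset α) :
    ∑ S ∈ K.powerset.filter (fun S => S.Nonempty ∧ S ≠ K), q ^ (#S * (#K - #S)) ≤
      2 * #K * (q⁻¹ * q ^ #K) + (q ^ 4)⁻¹ * (2 * q ^ 2) ^ #K := by
  have hsum : ∀ j : ℕ, (∑ S ∈ K.powerset, if #S = j then q⁻¹ * q ^ #K else 0) =
      (#K).choose j * (q⁻¹ * q ^ #K) := fun j => by
    rw [← Finset.sum_filter, ← Finset.powersetCard_eq_filter, Finset.sum_const,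
      Finset.card_powersetCard, nsmul_eq_mul]
  have hchoose : (#K).choose (#K - 1) ≤ #K ∨ #K = 0 := by
    rcases Nat.eq_zero_or_pos #K with h | h
    · exact Or.inr h
    · left
      rw [Nat.choose_symm (show 1 ≤ #K from h), Nat.choose_one_right]
  rcases hchoose with hc | h0
  · calc _ ≤ ∑ S ∈ K.powerset.filter (fun S => S.Nonempty ∧ S ≠ K),
          ((if #S = 1 then q⁻¹ * q ^ #K else 0) +
          (if #S = #K - 1 then q⁻¹ * q ^ #K else 0) + (q ^ 4)⁻¹ * (q ^ 2) ^ #K) := by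
          refine Finset.sum_le_sum fun S hS => ?_
          rw [mem_filter, mem_powerset] at hS
          exact pow_mul_sub_le hq0 hq1 hS.2.1.card_pos
            (Finset.card_lt_card (hS.1.ssubset_of_ne hS.2.2))
      _ ≤ ∑ S ∈ K.powerset, ((if #S = 1 then q⁻¹ * q ^ #K else 0) +
          (if #S = #K - 1 then q⁻¹ * q ^ #K else 0) + (q ^ 4)⁻¹ * (q ^ 2) ^ #K) :=
          Finset.sum_le_sum_of_subset_of_nonneg (Finset.filter_subset _ _)
            fun S _ _ => by positivity
      _ = #K * (q⁻¹ * q ^ #K) + (#K).choose (#K - 1) * (q⁻¹ * q ^ #K) +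
          (q ^ 4)⁻¹ * (2 * q ^ 2) ^ #K := by
          rw [Finset.sum_add_distrib, Finset.sum_add_distrib, hsum, hsum, Finset.sum_const,
            Finset.card_powerset, Nat.choose_one_right, nsmul_eq_mul, mul_pow]
          push_cast
          ring
      _ ≤ #K * (q⁻¹ * q ^ #K) + #K * (q⁻¹ * q ^ #K) + (q ^ 4)⁻¹ * (2 * q ^ 2) ^ #K := by
          gcongr
      _ = _ := by ring
  · rw [Finset.card_eq_zero] at h0
    subst h0
    rw [Finset.filter_eq_empty_iff.2, Finset.sum_empty]
    · positivity
    · intro S hS h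
      exact h.2 (Finset.subset_empty.1 (mem_powerset.1 hS))

/-- The probability that deleting the star of a given vertex disconnects the graph, bounded by
a double sum over complements of the star and their separations. -/
theorem sum_star_compl_separations_le {n : ℕ} {p : ℝ} (hp0 : 0 ≤ p) (hp1 : p < 1) (v : Fin n) :
    ∑ K ∈ (univ.erase v).powerset, ∑ S ∈ K.powerset.filter (fun S => S.Nonempty ∧ S ≠ K),
        p ^ (n - 1 - #K) * (1 - p) ^ #K * (1 - p) ^ (#S * (#K - #S)) ≤
      2 * n * (1 - p)⁻¹ * (p + (1 - p) ^ 2) ^ (n - 1) +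
        ((1 - p) ^ 4)⁻¹ * (p + 2 * (1 - p) ^ 3) ^ (n - 1) := by
  set q := 1 - p with hq
  have hq0 : 0 < q := by linarith
  have hq1 : q ≤ 1 := by linarith
  have hcard : #(univ.erase v) = n - 1 := by
    rw [Finset.card_erase_of_mem (mem_univ v), Finset.card_univ, Fintype.card_fin]
  have hbinom : ∀ x : ℝ, ∑ K ∈ (univ.erase v).powerset, x ^ #K * p ^ (n - 1 - #K) =
      (p + x) ^ (n - 1) := fun x => by
    rw [add_comm p x, ← hcard]
    exact Finset.sum_pow_mul_eq_add_pow x p _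
  rw [← hbinom, ← hbinom, Finset.mul_sum, Finset.mul_sum, ← Finset.sum_add_distrib]
  refine Finset.sum_le_sum fun K _ => ?_
  rw [← Finset.mul_sum]
  have hKn : (#K : ℝ) ≤ n := by exact_mod_cast K.card_le_univ.trans_eq (Fintype.card_fin n)
  calc _ ≤ p ^ (n - 1 - #K) * q ^ #K *
        (2 * #K * (q⁻¹ * q ^ #K) + (q ^ 4)⁻¹ * (2 * q ^ 2) ^ #K) := by
        gcongr
        refine le_of_eq_of_le ?_ (sum_separations_le hq0 hq1 K)
        congr!
    _ ≤ p ^ (n - 1 - #K) * q ^ #K *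
        (2 * n * (q⁻¹ * q ^ #K) + (q ^ 4)⁻¹ * (2 * q ^ 2) ^ #K) := by
        gcongr
    _ = _ := by
        rw [show 2 * q ^ 3 = q * (2 * q ^ 2) by ring, mul_pow q (2 * q ^ 2),
          show q ^ 2 = q * q by ring, mul_pow q q]
        ring

/-- The probability that `Γ ∈ G(n,p)` fails to be star 2-connected is at most
`2n²(1-p)⁻¹(p+(1-p)²)^{n-1} + n(1-p)⁻⁴(p+2(1-p)³)^{n-1}`. -/
theorem gnp_prob_not_star_two_connected_le (n : ℕ) (hn : 3 ≤ n) (p : ℝ)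
    (hp0 : 0 < p) (hp1 : p < 1) :
    gnpProb n p (fun Γ => ¬ StarTwoConnected Γ) ≤
      2 * (n : ℝ) ^ 2 * (1 - p)⁻¹ * (p + (1 - p) ^ 2) ^ (n - 1) +
        (n : ℝ) * (1 - p) ^ (-4 : ℤ) * (p + 2 * (1 - p) ^ 3) ^ (n - 1) := by
  have hcover : ∀ Γ : SimpleGraph (Fin n), ¬ StarTwoConnected Γ →
      ∃ i ∈ (univ : Finset (Fin n)).sigma fun v => (univ.erase v).powerset.sigma fun K =>
        K.powerset.filter (fun S => S.Nonempty ∧ S ≠ K),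
        (∀ u, u ∈ i.2.1 ↔ u ≠ i.1 ∧ ¬ Γ.Adj i.1 u) ∧
          ∀ s ∈ i.2.2, ∀ t ∈ i.2.1 \ i.2.2, ¬ Γ.Adj s t := by
    intro Γ hΓ
    obtain ⟨v, S, T, hS, hT, hST, hstar, hsep⟩ := not_not.1 hΓ
    refine ⟨⟨v, S ∪ T, S⟩, ?_, hstar, fun s hs t ht => hsep s hs t ?_⟩
    · simp only [mem_sigma, mem_univ, mem_powerset, mem_filter, true_and]
      refine ⟨fun u hu => mem_erase.2 ⟨((hstar u).1 hu).1, mem_univ u⟩, subset_union_left, hS,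
        fun h => ?_⟩
      obtain ⟨t, ht⟩ := hT
      exact Finset.disjoint_right.1 hST ht (h ▸ mem_union_right S ht)
    · exact (mem_union.1 (Finset.mem_sdiff.1 ht).1).resolve_left (Finset.mem_sdiff.1 ht).2
  refine (gnpProb_le_sum hp0.le hp1.le _ _ _ hcover).trans ?_
  rw [Finset.sum_sigma]
  calc _ ≤ ∑ _v : Fin n, (2 * n * (1 - p)⁻¹ * (p + (1 - p) ^ 2) ^ (n - 1) +
        ((1 - p) ^ 4)⁻¹ * (p + 2 * (1 - p) ^ 3) ^ (n - 1)) := by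
        refine Finset.sum_le_sum fun v _ => ?_
        rw [Finset.sum_sigma]
        refine le_trans (le_of_eq ?_) (sum_star_compl_separations_le hp0.le hp1 v)
        refine Finset.sum_congr rfl fun K hK => Finset.sum_congr rfl fun S hS => ?_
        exact gnpProb_star_compl_eq_and_separated
          (fun h => (mem_erase.1 (mem_powerset.1 hK h)).1 rfl)
          (mem_powerset.1 (mem_filter.1 hS).1)
    _ = _ := by
        rw [Finset.sum_const, Finset.card_univ, Fintype.card_fin, nsmul_eq_mul,
          show (1 - p) ^ (-4 : ℤ) = ((1 - p) ^ 4)⁻¹ by rw [zpow_neg]; norm_cast]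
        ring
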